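/- arXiv:2601.08350 — 4 statements merged into one kernel-verified Lean document; each statement's English description precedes it below -/
import Mathlib

section
/- Let ξ > 0, σ > 0, κ > 0, and let B : [0,1] → [0,1] be nondecreasing with B(1) = 1 such that the limit b₁ := lim_{u→1⁻} (1 − B(u))/(1 − u) exists with 0 < b₁ < ∞. Define F(y) = B(H_ξ(y/σ)^κ) for y ≥ 0. Then lim_{y→∞} (1 − F(y))/(1 − H_ξ(y/σ)) = κ·b₁. -/
open Filter Topology

/-- The generalized Pareto cdf `H_ξ(y) = 1 - (1 + ξ y)^(-1/ξ)`. -/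
noncomputable def Hgp (ξ y : ℝ) : ℝ := 1 - (1 + ξ * y) ^ (-(1 / ξ))

theorem tendsto_Hgp_atTop {ξ : ℝ} (hξ : 0 < ξ) : Tendsto (Hgp ξ) atTop (𝓝[<] 1) := by
  have hlin : Tendsto (fun y : ℝ => 1 + ξ * y) atTop atTop :=
    tendsto_atTop_add_const_left _ _ (tendsto_id.const_mul_atTop hξ)
  refine tendsto_nhdsWithin_iff.2 ⟨?_, ?_⟩
  · change Tendsto (fun y => 1 - (1 + ξ * y) ^ (-(1 / ξ))) atTop (𝓝 1)
    simpa [Function.comp_def] using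
      ((tendsto_rpow_neg_atTop (one_div_pos.2 hξ)).comp hlin).const_sub 1
  · filter_upwards [hlin.eventually_gt_atTop 0] with y hy
    have := Real.rpow_pos_of_pos hy (-(1 / ξ))
    simp only [Hgp, Set.mem_Iio]
    linarith

theorem tendsto_rpow_nhdsLT_one {κ : ℝ} (hκ : 0 < κ) :
    Tendsto (fun u : ℝ => u ^ κ) (𝓝[<] 1) (𝓝[<] 1) := by
  refine tendsto_nhdsWithin_iff.2 ⟨?_, ?_⟩
  · have h : ContinuousAt (fun u : ℝ => u ^ κ) 1 :=
      Real.continuousAt_rpow_const _ _ (Or.inl one_ne_zero)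
    simpa using h.tendsto.mono_left nhdsWithin_le_nhds
  · filter_upwards [Ioo_mem_nhdsLT (zero_lt_one' ℝ)] with u hu
    exact Real.rpow_lt_one hu.1.le hu.2 hκ

theorem tendsto_one_sub_rpow_div_one_sub (κ : ℝ) :
    Tendsto (fun u : ℝ => (1 - u ^ κ) / (1 - u)) (𝓝[<] 1) (𝓝 κ) := by
  have h : HasDerivAt (fun u : ℝ => u ^ κ) κ 1 := by
    simpa using Real.hasDerivAt_rpow_const (x := 1) (p := κ) (Or.inl one_ne_zero)
  refine (h.tendsto_slope.mono_left (nhdsWithin_mono _ fun u hu => ne_of_lt hu)).congr fun u => ?_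
  rw [slope_def_field, Real.one_rpow, ← neg_sub, ← neg_sub 1 u, neg_div_neg_eq]

theorem egpd_upper_tail
    (ξ σ κ : ℝ) (hξ : 0 < ξ) (hσ : 0 < σ) (hκ : 0 < κ)
    (B : ℝ → ℝ)
    (hBmaps : Set.MapsTo B (Set.Icc 0 1) (Set.Icc 0 1))
    (hBmono : MonotoneOn B (Set.Icc 0 1))
    (hB1 : B 1 = 1)
    (b₁ : ℝ) (hb₁ : 0 < b₁)
    (hlim : Tendsto (fun u => (1 - B u) / (1 - u)) (𝓝[<] (1 : ℝ)) (𝓝 b₁))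
    (F : ℝ → ℝ) (hF : ∀ y : ℝ, 0 ≤ y → F y = B ((Hgp ξ (y / σ)) ^ κ)) :
    Tendsto (fun y => (1 - F y) / (1 - Hgp ξ (y / σ))) atTop (𝓝 (κ * b₁)) := by
  have hH : Tendsto (fun y => Hgp ξ (y / σ)) atTop (𝓝[<] 1) :=
    (tendsto_Hgp_atTop hξ).comp (tendsto_id.atTop_div_const hσ)
  have hpow := (tendsto_rpow_nhdsLT_one hκ).comp hH
  refine (((tendsto_one_sub_rpow_div_one_sub κ).comp hH).mul (hlim.comp hpow)).congr' ?_
  filter_upwards [eventually_ge_atTop 0, hpow.eventually self_mem_nhdsWithin] with y hy hlt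
  have hne : 1 - Hgp ξ (y / σ) ^ κ ≠ 0 := (sub_pos.2 hlt).ne'
  simp only [Function.comp_apply]
  rw [hF y hy, mul_comm, div_mul_div_cancel₀ hne]
end

section
/- For all real numbers 0 < λ₁ ≤ λ₂ and every integer n ≥ 1, the Poisson distributions truncated to be positive are stochastically ordered: (Σ_{k=n}^{∞} λ₁^k/k!) / (e^{λ₁} − 1) ≤ (Σ_{k=n}^{∞} λ₂^k/k!) / (e^{λ₂} − 1). Equivalently, if N₁ and N₂ are Poisson random variables with means λ₁ and λ₂, then P(N₁ ≥ n | N₁ ≥ 1) ≤ P(N₂ ≥ n | N₂ ≥ 1) for all n ≥ 1. -/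
open Finset in
theorem hasSum_exp_tail (x : ℝ) {n : ℕ} (hn : 1 ≤ n) :
    HasSum (fun k : ℕ => if n ≤ k then x ^ k / (Nat.factorial k : ℝ) else 0)
      (Real.exp x - 1 - ∑ k ∈ Ico 1 n, x ^ k / (Nat.factorial k : ℝ)) := by
  have hexp : HasSum (fun k : ℕ => x ^ k / (Nat.factorial k : ℝ)) (Real.exp x) := by
    rw [Real.exp_eq_exp_ℝ]
    exact NormedSpace.expSeries_div_hasSum_exp x
  have hhead : HasSum (fun k : ℕ => if k < n then x ^ k / (Nat.factorial k : ℝ) else 0)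
      (∑ k ∈ range n, if k < n then x ^ k / (Nat.factorial k : ℝ) else 0) :=
    hasSum_sum_of_ne_finset_zero fun k hk => if_neg (by simpa using hk)
  convert! hexp.sub hhead using 1
  · ext k
    by_cases h : n ≤ k
    · simp [h, not_lt.2 h]
    · simp [h, not_le.1 h]
  · rw [sum_congr rfl fun k hk => if_pos (mem_range.1 hk), range_eq_Ico,
      sum_eq_sum_Ico_succ_bot (a := 0) (by lia)]
    simp
    ring

theorem pow_mul_pow_le_pow_mul_pow {a b : ℝ} (ha : 0 ≤ a) (hab : a ≤ b) {m k : ℕ}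
    (hmk : m ≤ k) : b ^ m * a ^ k ≤ a ^ m * b ^ k := by
  obtain ⟨d, rfl⟩ := Nat.exists_eq_add_of_le hmk
  have hb : 0 ≤ b := ha.trans hab
  calc b ^ m * a ^ (m + d) = a ^ m * b ^ m * a ^ d := by ring
    _ ≤ a ^ m * b ^ m * b ^ d := by gcongr
    _ = a ^ m * b ^ (m + d) := by ring

theorem truncated_poisson_stochastic_order
    (lam1 lam2 : ℝ) (hlam1 : 0 < lam1) (hlam12 : lam1 ≤ lam2)
    (n : ℕ) (hn : 1 ≤ n) :
    (∑' k : ℕ, if n ≤ k then lam1 ^ k / (Nat.factorial k : ℝ) else 0) /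
        (Real.exp lam1 - 1) ≤
      (∑' k : ℕ, if n ≤ k then lam2 ^ k / (Nat.factorial k : ℝ) else 0) /
        (Real.exp lam2 - 1) := by
  have hlam2 : 0 < lam2 := hlam1.trans_le hlam12
  have h1 := hasSum_exp_tail lam1 hn
  have h2 := hasSum_exp_tail lam2 hn
  have htail := hasSum_le (fun k => ?_) (h1.mul_left (lam2 ^ n)) (h2.mul_left (lam1 ^ n))
  · have hhead : lam1 ^ n * ∑ k ∈ Finset.Ico 1 n, lam2 ^ k / (Nat.factorial k : ℝ) ≤
        lam2 ^ n * ∑ k ∈ Finset.Ico 1 n, lam1 ^ k / (Nat.factorial k : ℝ) := by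
      simp_rw [Finset.mul_sum, ← mul_div_assoc]
      refine Finset.sum_le_sum fun k hk => ?_
      have := pow_mul_pow_le_pow_mul_pow hlam1.le hlam12 (Finset.mem_Ico.1 hk).2.le
      gcongr ?_ / _
      linarith
    have hnonneg : 0 ≤ Real.exp lam1 - 1 -
        ∑ k ∈ Finset.Ico 1 n, lam1 ^ k / (Nat.factorial k : ℝ) :=
      h1.nonneg fun k => by split_ifs <;> positivity
    have hsum : 0 ≤ ∑ k ∈ Finset.Ico 1 n, lam1 ^ k / (Nat.factorial k : ℝ) :=
      Finset.sum_nonneg fun k _ => by positivity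
    rw [h1.tsum_eq, h2.tsum_eq, div_le_div_iff₀ (sub_pos.2 (Real.one_lt_exp_iff.2 hlam1))
      (sub_pos.2 (Real.one_lt_exp_iff.2 hlam2))]
    refine le_of_mul_le_mul_left ?_ (pow_pos hlam1 n)
    linear_combination mul_le_mul_of_nonneg_left hhead hnonneg +
      mul_le_mul_of_nonneg_right htail hsum
  · split_ifs with h
    · rw [← mul_div_assoc, ← mul_div_assoc]
      gcongr ?_ / _
      exact pow_mul_pow_le_pow_mul_pow hlam1.le hlam12 h
    · simp
end

section
/- Let κ₁, κ₂ > 0 and let f₁, f₂ : (0, ∞) → [0, ∞) be measurable functions such that lim_{x→0⁺} f_i(x)/x^{κ_i − 1} = K_i with 0 < K_i < ∞ for i = 1, 2. Then lim_{x→0⁺} (∫_0^x f₁(u)·f₂(x − u) du) / x^{κ₁ + κ₂ − 1} = K₁·K₂·𝔅(κ₁, κ₂), where 𝔅(a, b) = ∫_0^1 v^{a−1}(1 − v)^{b−1} dv is the Beta function. In particular, if X₁ and X₂ are independent positive random variables with probability density functions f₁ and f₂ satisfying these limit conditions, the density f_{X₁+X₂} of X₁ + X₂ satisfies lim_{x→0⁺}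 f_{X₁+X₂}(x)/x^{κ₁+κ₂−1} = K₁·K₂·𝔅(κ₁, κ₂). -/
open MeasureTheory ProbabilityTheory Filter Topology

theorem intervalIntegrable_rpow_mul_one_sub_rpow {a b : ℝ} (ha : 0 < a) (hb : 0 < b) :
    IntervalIntegrable (fun v : ℝ => v ^ (a - 1) * (1 - v) ^ (b - 1)) volume 0 1 := by
  have h := (Complex.betaIntegral_convergent (u := a) (v := b) (by simpa) (by simpa)).norm
  refine h.congr_uIoo fun v hv => ?_
  rw [Set.uIoo_of_le zero_le_one] at hv
  have h1 : (0 : ℝ) < 1 - v := sub_pos.2 hv.2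
  have e1 : ((v : ℂ)) ^ ((a : ℂ) - 1) = ((v ^ (a - 1) : ℝ) : ℂ) := by
    rw [Complex.ofReal_cpow hv.1.le]; simp
  have e2 : (1 - (v : ℂ)) ^ ((b : ℂ) - 1) = (((1 - v) ^ (b - 1) : ℝ) : ℂ) := by
    rw [Complex.ofReal_cpow h1.le]; simp
  simp only [e1, e2]
  rw [← Complex.ofReal_mul, Complex.norm_real, Real.norm_eq_abs,
    abs_of_nonneg (mul_nonneg (Real.rpow_nonneg hv.1.le _) (Real.rpow_nonneg h1.le _))]

theorem integral_mul_comp_sub_div_rpow_eq {a b x : ℝ} (hx : 0 < x) (f g : ℝ → ℝ) :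
    (∫ u in (0 : ℝ)..x, f u * g (x - u)) / x ^ (a + b - 1) =
      ∫ v in (0 : ℝ)..1, f (x * v) / (x * v) ^ (a - 1) *
        (g (x * (1 - v)) / (x * (1 - v)) ^ (b - 1)) * (v ^ (a - 1) * (1 - v) ^ (b - 1)) := by
  have h := intervalIntegral.smul_integral_comp_mul_left (a := 0) (b := 1)
    (fun u => f u * g (x - u)) x
  simp only [mul_zero, mul_one, smul_eq_mul] at h
  rw [← h, mul_div_right_comm, ← intervalIntegral.integral_const_mul]
  refine intervalIntegral.integral_congr_uIoo fun v hv => ?_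
  rw [Set.uIoo_of_le zero_le_one] at hv
  have h1 : (0 : ℝ) < 1 - v := sub_pos.2 hv.2
  have e : x ^ (a + b - 1) = x * (x ^ (a - 1) * x ^ (b - 1)) := by
    rw [← Real.rpow_add hx, mul_comm, ← Real.rpow_add_one hx.ne']
    ring_nf
  simp only [Real.mul_rpow hx.le hv.1.le, Real.mul_rpow hx.le h1.le, e,
    show x - x * v = x * (1 - v) by ring]
  have := Real.rpow_pos_of_pos hx (a - 1)
  have := Real.rpow_pos_of_pos hx (b - 1)
  have := Real.rpow_pos_of_pos hv.1 (a - 1)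
  have := Real.rpow_pos_of_pos h1 (b - 1)
  field_simp

theorem tendsto_integral_mul_comp_sub_div_rpow {a b K L : ℝ} (ha : 0 < a) (hb : 0 < b)
    {f g : ℝ → ℝ} (hf : Measurable f) (hg : Measurable g)
    (hfK : Tendsto (fun x => f x / x ^ (a - 1)) (𝓝[>] (0 : ℝ)) (𝓝 K))
    (hgL : Tendsto (fun x => g x / x ^ (b - 1)) (𝓝[>] (0 : ℝ)) (𝓝 L)) :
    Tendsto (fun x => (∫ u in (0 : ℝ)..x, f u * g (x - u)) / x ^ (a + b - 1))
      (𝓝[>] (0 : ℝ)) (𝓝 (K * L * ∫ v in (0 : ℝ)..1, v ^ (a - 1) * (1 - v) ^ (b - 1))) := by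
  have hscale {v : ℝ} (hv : 0 < v) : Tendsto (fun x : ℝ => x * v) (𝓝[>] 0) (𝓝[>] 0) := by
    refine tendsto_nhdsWithin_iff.2 ⟨?_, ?_⟩
    · exact ((continuous_mul_const v).tendsto' 0 0 (zero_mul v)).mono_left nhdsWithin_le_nhds
    · filter_upwards [self_mem_nhdsWithin] with x hx using mul_pos hx hv
  have hbound {h : ℝ → ℝ} {M : ℝ} (hM : Tendsto h (𝓝[>] 0) (𝓝 M)) :
      ∃ δ > 0, ∀ t ∈ Set.Ioo 0 δ, ‖h t‖ ≤ ‖M‖ + 1 :=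
    mem_nhdsGT_iff_exists_Ioo_subset.1 (hM.norm.eventually_le_const (lt_add_one _))
  obtain ⟨δ, hδ, hδf⟩ := hbound hfK
  obtain ⟨ε, hε, hεg⟩ := hbound hgL
  rw [← intervalIntegral.integral_const_mul]
  refine Tendsto.congr' (f₁ := fun x => ∫ v in (0 : ℝ)..1, f (x * v) / (x * v) ^ (a - 1) *
        (g (x * (1 - v)) / (x * (1 - v)) ^ (b - 1)) * (v ^ (a - 1) * (1 - v) ^ (b - 1))) ?_ ?_
  · filter_upwards [self_mem_nhdsWithin] with x hx
    exact (integral_mul_comp_sub_div_rpow_eq hx f g).symm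
  have hne : ∀ᵐ v : ℝ, v ≠ 1 := by simp [ae_iff]
  refine intervalIntegral.tendsto_integral_filter_of_dominated_convergence
    (fun v => (‖K‖ + 1) * (‖L‖ + 1) * (v ^ (a - 1) * (1 - v) ^ (b - 1))) ?_ ?_
    ((intervalIntegrable_rpow_mul_one_sub_rpow ha hb).const_mul _) ?_
  · exact Eventually.of_forall fun x => Measurable.aestronglyMeasurable (by fun_prop)
  · filter_upwards [Ioo_mem_nhdsGT (lt_min hδ hε)] with x hx
    filter_upwards [hne] with v hv1 hv
    rw [Set.uIoc_of_le zero_le_one] at hv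
    have hv' : v < 1 := lt_of_le_of_ne hv.2 hv1
    have h1 : (0 : ℝ) < 1 - v := sub_pos.2 hv'
    rw [norm_mul, norm_mul, Real.norm_of_nonneg
      (mul_nonneg (Real.rpow_nonneg hv.1.le _) (Real.rpow_nonneg h1.le _))]
    have hxδ := hx.2.trans_le (min_le_left _ _)
    have hxε := hx.2.trans_le (min_le_right _ _)
    have b1 := hδf (x * v) ⟨mul_pos hx.1 hv.1, by nlinarith [hx.1]⟩
    have b2 := hεg (x * (1 - v)) ⟨mul_pos hx.1 h1, by nlinarith [hx.1, hv.1]⟩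
    have := Real.rpow_nonneg hv.1.le (a - 1)
    have := Real.rpow_nonneg h1.le (b - 1)
    gcongr
  · filter_upwards [hne] with v hv1 hv
    rw [Set.uIoc_of_le zero_le_one] at hv
    have hv' : v < 1 := lt_of_le_of_ne hv.2 hv1
    exact ((hfK.comp (hscale hv.1)).mul (hgL.comp (hscale (sub_pos.2 hv')))).mul_const _

theorem lconvolution_ofReal_eq_lintegral_Ioc {f g : ℝ → ℝ}
    (hf : ∀ x ≤ (0 : ℝ), f x = 0) (hg : ∀ x ≤ (0 : ℝ), g x = 0) (hf0 : ∀ x, 0 ≤ f x) (x : ℝ) :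
    ((fun y => ENNReal.ofReal (f y)) ⋆ₗ[volume] fun y => ENNReal.ofReal (g y)) x =
      ∫⁻ u in Set.Ioc 0 x, ENNReal.ofReal (f u * g (x - u)) := by
  rw [lconvolution_def, ← lintegral_indicator measurableSet_Ioc]
  refine lintegral_congr fun u => ?_
  rw [neg_add_eq_sub]
  by_cases hu : u ∈ Set.Ioc 0 x
  · rw [Set.indicator_of_mem hu, ENNReal.ofReal_mul (hf0 u)]
  · rw [Set.indicator_of_notMem hu]
    rcases le_or_gt u 0 with h | h
    · simp [hf u h]
    · have : x < u := not_le.1 fun h' => hu ⟨h, h'⟩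
      simp [hg (x - u) (by linarith)]

theorem ofReal_intervalIntegral_mul_comp_sub {f g : ℝ → ℝ} (hfm : Measurable f)
    (hgm : Measurable g) (hf0 : ∀ x, 0 ≤ f x) (hg0 : ∀ x, 0 ≤ g x)
    (hf : ∀ x ≤ (0 : ℝ), f x = 0) {x : ℝ}
    (hfin : ∫⁻ u in Set.Ioc 0 x, ENNReal.ofReal (f u * g (x - u)) ≠ ⊤) :
    ENNReal.ofReal (∫ u in (0 : ℝ)..x, f u * g (x - u)) =
      ∫⁻ u in Set.Ioc 0 x, ENNReal.ofReal (f u * g (x - u)) := by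
  rcases le_total 0 x with hx | hx
  · rw [intervalIntegral.integral_of_le hx, integral_eq_lintegral_of_nonneg_ae
      (Eventually.of_forall fun u => mul_nonneg (hf0 u) (hg0 _))
      (Measurable.aestronglyMeasurable (by fun_prop)), ENNReal.ofReal_toReal hfin]
  · rw [intervalIntegral.integral_zero_ae, Set.Ioc_eq_empty hx.not_gt]
    · simp
    · refine Eventually.of_forall fun u hu => ?_
      rw [Set.uIoc_of_ge hx] at hu
      simp [hf u hu.2]

theorem conv_withDensity_ofReal_eq {f g : ℝ → ℝ} (hfm : Measurable f) (hgm : Measurable g)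
    (hf0 : ∀ x, 0 ≤ f x) (hg0 : ∀ x, 0 ≤ g x)
    (hf : ∀ x ≤ (0 : ℝ), f x = 0) (hg : ∀ x ≤ (0 : ℝ), g x = 0)
    [IsFiniteMeasure (volume.withDensity fun x => ENNReal.ofReal (f x))]
    [IsFiniteMeasure (volume.withDensity fun x => ENNReal.ofReal (g x))] :
    (volume.withDensity fun x => ENNReal.ofReal (f x)) ∗
        (volume.withDensity fun x => ENNReal.ofReal (g x)) =
      volume.withDensity fun x =>
        ENNReal.ofReal (∫ u in (0 : ℝ)..x, f u * g (x - u)) := by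
  have hconv := conv_withDensity_eq_lconvolution (μ := (volume : Measure ℝ))
    hfm.ennreal_ofReal hgm.ennreal_ofReal
  have hmeas := measurable_lconvolution (volume : Measure ℝ)
    hfm.ennreal_ofReal hgm.ennreal_ofReal
  rw [hconv]
  refine withDensity_congr_ae ?_
  have hlt := ae_lt_top hmeas (by
    rw [← setLIntegral_univ, ← withDensity_apply _ MeasurableSet.univ, ← hconv]
    exact measure_ne_top _ _)
  filter_upwards [hlt] with x hx
  rw [lconvolution_ofReal_eq_lintegral_Ioc hf hg hf0] at hx ⊢
  exact (ofReal_intervalIntegral_mul_comp_sub hfm hgm hf0 hg0 hf hx.ne).symm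

theorem convolution_lower_tail
    {Ω : Type*} [MeasurableSpace Ω]
    (μ : Measure Ω) [IsProbabilityMeasure μ]
    (κ1 κ2 K1 K2 : ℝ) (hκ1 : 0 < κ1) (hκ2 : 0 < κ2) (hK1 : 0 < K1) (hK2 : 0 < K2)
    (f1 f2 : ℝ → ℝ)
    (hf1meas : Measurable f1) (hf2meas : Measurable f2)
    (hf1nn : ∀ x, 0 ≤ f1 x) (hf2nn : ∀ x, 0 ≤ f2 x)
    (hf1zero : ∀ x ≤ (0 : ℝ), f1 x = 0) (hf2zero : ∀ x ≤ (0 : ℝ), f2 x = 0)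
    (hlim1 : Tendsto (fun x => f1 x / x ^ (κ1 - 1)) (𝓝[>] (0 : ℝ)) (𝓝 K1))
    (hlim2 : Tendsto (fun x => f2 x / x ^ (κ2 - 1)) (𝓝[>] (0 : ℝ)) (𝓝 K2)) :
    Tendsto (fun x => (∫ u in (0 : ℝ)..x, f1 u * f2 (x - u)) / x ^ (κ1 + κ2 - 1))
        (𝓝[>] (0 : ℝ))
        (𝓝 (K1 * K2 * ∫ v in (0 : ℝ)..1, v ^ (κ1 - 1) * (1 - v) ^ (κ2 - 1))) ∧
      -- In particular, for independent positive random variables `X1, X2` with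
      -- densities `f1, f2`, the convolution above is a density of `X1 + X2`,
      -- so the density of the sum satisfies the same limit.
      ∀ X1 X2 : Ω → ℝ, Measurable X1 → Measurable X2 →
        (∀ᵐ ω ∂μ, 0 < X1 ω) → (∀ᵐ ω ∂μ, 0 < X2 ω) →
        IndepFun X1 X2 μ →
        Measure.map X1 μ = volume.withDensity (fun x => ENNReal.ofReal (f1 x)) →
        Measure.map X2 μ = volume.withDensity (fun x => ENNReal.ofReal (f2 x)) →
        Measure.map (fun ω => X1 ω + X2 ω) μ =
          volume.withDensity
            (fun x => ENNReal.ofReal (∫ u in (0 : ℝ)..x, f1 u * f2 (x - u))) := by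
  refine ⟨tendsto_integral_mul_comp_sub_div_rpow hκ1 hκ2 hf1meas hf2meas hlim1 hlim2, ?_⟩
  intro X1 X2 hX1 hX2 _ _ hindep h1 h2
  have : IsFiniteMeasure (volume.withDensity fun x => ENNReal.ofReal (f1 x)) :=
    h1 ▸ inferInstance
  have : IsFiniteMeasure (volume.withDensity fun x => ENNReal.ofReal (f2 x)) :=
    h2 ▸ inferInstance
  have hsum := hindep.map_add_eq_map_conv_map hX1 hX2
  rw [h1, h2, conv_withDensity_ofReal_eq hf1meas hf2meas hf1nn hf2nn hf1zero hf2zero] at hsum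
  exact hsum
end

section
/- Let κ > 0, let f : (0, ∞) → [0, ∞) be measurable with lim_{x→0⁺} f(x)/x^{κ−1} = K for some 0 < K < ∞, and for d ≥ 1 let f^{*d} denote the d-fold convolution of f, defined by f^{*1} = f and f^{*(d+1)}(x) = ∫_0^x f^{*d}(u)·f(x − u) du. Then for every integer d ≥ 1, lim_{x→0⁺} f^{*d}(x)/x^{dκ − 1} = K^d · Γ(κ)^d / Γ(dκ), where Γ is the Gamma function. -/
open MeasureTheory Filter Topology

/-- `convPow f d` is the `d`-fold convolution `f^{*d}` (on `(0, ∞)`), with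
`f^{*1} = f` and `f^{*(d+1)}(x) = ∫_0^x f^{*d}(u) f(x - u) du`.
The value for `d = 0` is irrelevant and set to `0`. -/
noncomputable def convPow (f : ℝ → ℝ) : ℕ → ℝ → ℝ
  | 0 => fun _ => 0
  | 1 => f
  | n + 2 => fun x => ∫ u in (0 : ℝ)..x, convPow f (n + 1) u * f (x - u)

theorem ofReal_beta_integrand (a b : ℝ) {t : ℝ} (ht : t ∈ Set.Icc (0 : ℝ) 1) :
    ((t ^ (a - 1) * (1 - t) ^ (b - 1) : ℝ) : ℂ) =
      (t : ℂ) ^ ((a : ℂ) - 1) * (1 - (t : ℂ)) ^ ((b : ℂ) - 1) := by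
  rw [Complex.ofReal_mul, Complex.ofReal_cpow ht.1, Complex.ofReal_cpow (sub_nonneg.2 ht.2)]
  push_cast
  rfl

theorem intervalIntegrable_beta_integrand {a b : ℝ} (ha : 0 < a) (hb : 0 < b) :
    IntervalIntegrable (fun t : ℝ => t ^ (a - 1) * (1 - t) ^ (b - 1)) volume 0 1 := by
  have h := Complex.betaIntegral_convergent (u := a) (v := b) (by simpa) (by simpa)
  rw [intervalIntegrable_iff] at h ⊢
  refine IntegrableOn.congr_fun h.re (fun t ht => ?_) measurableSet_uIoc
  rw [Set.uIoc_of_le zero_le_one] at ht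
  simp only [← ofReal_beta_integrand a b (Set.Ioc_subset_Icc_self ht)]
  exact Complex.ofReal_re _

theorem integral_beta_integrand {a b : ℝ} (ha : 0 < a) (hb : 0 < b) :
    ∫ t in (0 : ℝ)..1, t ^ (a - 1) * (1 - t) ^ (b - 1) =
      Real.Gamma a * Real.Gamma b / Real.Gamma (a + b) := by
  have h := ProbabilityTheory.beta_eq_betaIntegralReal a b ha hb
  rw [ProbabilityTheory.beta] at h
  rw [h, Complex.betaIntegral, ← Complex.ofReal_re (∫ t in (0 : ℝ)..1, _),
    ← intervalIntegral.integral_ofReal]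
  congr 1
  refine intervalIntegral.integral_congr fun t ht => ?_
  rw [Set.uIcc_of_le zero_le_one] at ht
  exact ofReal_beta_integrand a b ht

theorem eventually_forall_Ioo_abs_le {φ : ℝ → ℝ} {A : ℝ}
    (h : Tendsto φ (𝓝[>] (0 : ℝ)) (𝓝 A)) :
    ∀ᶠ x in 𝓝[>] (0 : ℝ), ∀ y ∈ Set.Ioo 0 x, |φ y| ≤ |A| + 1 := by
  have h₁ : ∀ᶠ y in 𝓝[>] (0 : ℝ), |φ y| ≤ |A| + 1 :=
    h.abs.eventually (Iic_mem_nhds (lt_add_one |A|))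
  obtain ⟨δ, hδ, hsub⟩ := mem_nhdsGT_iff_exists_Ioo_subset.1 h₁
  filter_upwards [Ioo_mem_nhdsGT hδ] with x hx y hy
  exact hsub ⟨hy.1, hy.2.trans hx.2⟩

theorem tendsto_mul_const_nhdsGT_zero {c : ℝ} (hc : 0 < c) :
    Tendsto (fun x : ℝ => x * c) (𝓝[>] 0) (𝓝[>] 0) := by
  refine tendsto_nhdsWithin_iff.2 ⟨?_, ?_⟩
  · have : Tendsto (fun x : ℝ => x * c) (𝓝 0) (𝓝 (0 * c)) := tendsto_id.mul_const c
    rw [zero_mul] at this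
    exact this.mono_left nhdsWithin_le_nhds
  · filter_upwards [self_mem_nhdsWithin] with x hx
    exact mul_pos hx hc

/-- After rescaling to the unit interval, a convolution is a Beta integral weighted by the
normalized factors. -/
theorem convolution_div_rpow_eq (g h : ℝ → ℝ) (a b : ℝ) {x : ℝ} (hx : 0 < x) :
    (∫ u in (0 : ℝ)..x, g u * h (x - u)) / x ^ (a + b - 1) =
      ∫ t in (0 : ℝ)..1,
        (g (x * t) / (x * t) ^ (a - 1)) * (h (x * (1 - t)) / (x * (1 - t)) ^ (b - 1)) *
          (t ^ (a - 1) * (1 - t) ^ (b - 1)) := by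
  have hscale := intervalIntegral.smul_integral_comp_mul_left
    (a := 0) (b := 1) (fun u => g u * h (x - u)) x
  rw [mul_zero, mul_one] at hscale
  rw [← hscale, smul_eq_mul, mul_div_right_comm, ← intervalIntegral.integral_const_mul]
  refine intervalIntegral.integral_congr_ae ?_
  filter_upwards [compl_mem_ae_iff.2 (measure_singleton (μ := volume) (1 : ℝ))] with t ht1 ht
  rw [Set.uIoc_of_le zero_le_one] at ht
  have h0 : 0 < t := ht.1
  have h1 : 0 < 1 - t := sub_pos.2 (lt_of_le_of_ne ht.2 ht1)
  have hpow : x ^ (a + b - 1) = x * (x ^ (a - 1) * x ^ (b - 1)) := by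
    rw [← Real.rpow_add hx, mul_comm x, ← Real.rpow_add_one hx.ne']
    congr 1
    ring
  rw [Real.mul_rpow hx.le h0.le, Real.mul_rpow hx.le h1.le, hpow, mul_sub, mul_one]
  have := (Real.rpow_pos_of_pos hx (a - 1)).ne'
  have := (Real.rpow_pos_of_pos hx (b - 1)).ne'
  have := (Real.rpow_pos_of_pos h0 (a - 1)).ne'
  have := (Real.rpow_pos_of_pos h1 (b - 1)).ne'
  field_simp

theorem tendsto_convolution_div_rpow {g h : ℝ → ℝ} (hg : Measurable g) (hh : Measurable h)
    {a b A B : ℝ} (ha : 0 < a) (hb : 0 < b)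
    (hgA : Tendsto (fun x => g x / x ^ (a - 1)) (𝓝[>] (0 : ℝ)) (𝓝 A))
    (hhB : Tendsto (fun x => h x / x ^ (b - 1)) (𝓝[>] (0 : ℝ)) (𝓝 B)) :
    Tendsto (fun x => (∫ u in (0 : ℝ)..x, g u * h (x - u)) / x ^ (a + b - 1)) (𝓝[>] (0 : ℝ))
      (𝓝 (A * B * (Real.Gamma a * Real.Gamma b / Real.Gamma (a + b)))) := by
  rw [← integral_beta_integrand ha hb, ← intervalIntegral.integral_const_mul]
  refine Tendsto.congr' (f₁ := fun x => ∫ t in (0 : ℝ)..1,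
        (g (x * t) / (x * t) ^ (a - 1)) * (h (x * (1 - t)) / (x * (1 - t)) ^ (b - 1)) *
          (t ^ (a - 1) * (1 - t) ^ (b - 1))) ?_ ?_
  · filter_upwards [self_mem_nhdsWithin] with x hx
    exact (convolution_div_rpow_eq g h a b hx).symm
  have hne : ∀ᵐ t : ℝ, t ≠ 1 := compl_mem_ae_iff.2 (measure_singleton 1)
  refine intervalIntegral.tendsto_integral_filter_of_dominated_convergence
    (fun t => (|A| + 1) * (|B| + 1) * (t ^ (a - 1) * (1 - t) ^ (b - 1))) ?_ ?_
    ((intervalIntegrable_beta_integrand ha hb).const_mul _) ?_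
  · exact Eventually.of_forall fun x => Measurable.aestronglyMeasurable (by fun_prop)
  · filter_upwards [self_mem_nhdsWithin, eventually_forall_Ioo_abs_le hgA,
      eventually_forall_Ioo_abs_le hhB] with x hx hgx hhx
    filter_upwards [hne] with t ht1 ht
    rw [Set.uIoc_of_le zero_le_one] at ht
    have hx : 0 < x := hx
    have h0 : 0 < t := ht.1
    have h1 : 0 < 1 - t := sub_pos.2 (lt_of_le_of_ne ht.2 ht1)
    have hw : 0 ≤ t ^ (a - 1) * (1 - t) ^ (b - 1) := by positivity
    rw [Real.norm_eq_abs, abs_mul, abs_mul, abs_of_nonneg hw]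
    gcongr
    · exact hgx _ ⟨mul_pos hx h0, by nlinarith⟩
    · exact hhx _ ⟨mul_pos hx h1, by nlinarith⟩
  · filter_upwards [hne] with t ht1 ht
    rw [Set.uIoc_of_le zero_le_one] at ht
    have h1 : 0 < 1 - t := sub_pos.2 (lt_of_le_of_ne ht.2 ht1)
    exact ((hgA.comp (tendsto_mul_const_nhdsGT_zero ht.1)).mul
      (hhB.comp (tendsto_mul_const_nhdsGT_zero h1))).mul_const _

theorem Measurable.intervalIntegral_zero_convolution {g h : ℝ → ℝ} (hg : Measurable g)
    (hh : Measurable h) : Measurable fun x => ∫ u in (0 : ℝ)..x, g u * h (x - u) := by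
  have hF : Measurable fun p : ℝ × ℝ => g p.2 * h (p.1 - p.2) := by fun_prop
  have hpos : MeasurableSet {p : ℝ × ℝ | 0 < p.2 ∧ p.2 ≤ p.1} :=
    (measurableSet_lt measurable_const measurable_snd).inter
      (measurableSet_le measurable_snd measurable_fst)
  have hneg : MeasurableSet {p : ℝ × ℝ | p.1 < p.2 ∧ p.2 ≤ 0} :=
    (measurableSet_lt measurable_fst measurable_snd).inter
      (measurableSet_le measurable_snd measurable_const)
  have h₁ := (hF.indicator hpos).stronglyMeasurable.integral_prod_right' (ν := volume)
  have h₂ := (hF.indicator hneg).stronglyMeasurable.integral_prod_right' (ν := volume)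
  convert! (h₁.sub h₂).measurable using 1
  ext x
  rw [intervalIntegral, ← integral_indicator measurableSet_Ioc,
    ← integral_indicator measurableSet_Ioc]
  rfl

theorem measurable_convPow {f : ℝ → ℝ} (hf : Measurable f) : ∀ d, Measurable (convPow f d)
  | 0 => measurable_const
  | 1 => hf
  | d + 2 => (measurable_convPow hf (d + 1)).intervalIntegral_zero_convolution hf

theorem convPow_lower_tail
    (κ K : ℝ) (hκ : 0 < κ) (hK : 0 < K)
    (f : ℝ → ℝ) (hfmeas : Measurable f) (hfnn : ∀ x, 0 ≤ f x)
    (hlim : Tendsto (fun x => f x / x ^ (κ - 1)) (𝓝[>] (0 : ℝ)) (𝓝 K)) :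
    ∀ d : ℕ, 1 ≤ d →
      Tendsto (fun x => convPow f d x / x ^ ((d : ℝ) * κ - 1)) (𝓝[>] (0 : ℝ))
        (𝓝 (K ^ d * Real.Gamma κ ^ d / Real.Gamma ((d : ℝ) * κ))) := by
  intro d hd
  induction d, hd using Nat.le_induction with
  | base =>
    have hΓ := (Real.Gamma_pos_of_pos hκ).ne'
    simpa [convPow, hΓ] using hlim
  | succ d hd ih =>
    have hdκ : 0 < (d : ℝ) * κ := mul_pos (by exact_mod_cast hd) hκ
    have hΓ := (Real.Gamma_pos_of_pos hdκ).ne'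
    have key := tendsto_convolution_div_rpow (measurable_convPow hfmeas d) hfmeas hdκ hκ ih hlim
    have hexp : ((d + 1 : ℕ) : ℝ) * κ = (d : ℝ) * κ + κ := by push_cast; ring
    obtain ⟨n, rfl⟩ := Nat.exists_eq_succ_of_ne_zero (Nat.one_le_iff_ne_zero.1 hd)
    rw [hexp]
    convert! key using 2
    field_simp
    ring
end
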